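/- arXiv:math/0409070 — 7 statements merged into one kernel-verified Lean document; each statement's English description precedes it below -/
import Mathlib

section
/- The sequent calculus LJ+ (LJ extended with the neutralization rule) derives exactly the same sequents as intuitionistic first-order sequent calculus LJ extended with the axiom schema ⊢ A ∨ ¬A for every propositional symbol A. In particular, every application of the neutralization rule can be eliminated in favor of uses of excluded middle for propositional formulas, and conversely every instance ⊢ N ∨ ¬N for a propositional symbol N is derivable using the neutralization rule. -/
/-! Syntax of first-order formulas. Atoms are either propositional symbols
(arity-0) or predicate symbols of arity ≥ 1 applied to variables.
There are no function symbols or object constants: terms are variables (ℕ). -/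

inductive Formula : Type
  | prop : ℕ → Formula                      -- propositional symbol
  | pred : ℕ → ℕ → List ℕ → Formula         -- predicate symbol (arity ≥ 1) applied to variables
  | top : Formula
  | bot : Formula
  | and : Formula → Formula → Formula
  | or : Formula → Formula → Formula
  | imp : Formula → Formula → Formula
  | neg : Formula → Formula
  | all : ℕ → Formula → Formula             -- ∀x A
  | ex : ℕ → Formula → Formula              -- ∃x A
  deriving DecidableEq

namespace Formula

/-- Free variables of a formula. -/
def fv : Formula → Finset ℕ
  | prop _ => ∅
  | pred _ x xs => insert x xs.toFinset
  | top => ∅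
  | bot => ∅
  | and A B => fv A ∪ fv B
  | or A B => fv A ∪ fv B
  | imp A B => fv A ∪ fv B
  | neg A => fv A
  | all x A => (fv A).erase x
  | ex x A => (fv A).erase x

/-- All variables occurring in a formula (free or bound, including binders). -/
def vars : Formula → Finset ℕ
  | prop _ => ∅
  | pred _ x xs => insert x xs.toFinset
  | top => ∅
  | bot => ∅
  | and A B => vars A ∪ vars B
  | or A B => vars A ∪ vars B
  | imp A B => vars A ∪ vars B
  | neg A => vars A
  | all x A => insert x (vars A)
  | ex x A => insert x (vars A)

/-- Binder variables of a formula. -/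
def bv : Formula → Finset ℕ
  | prop _ => ∅
  | pred _ _ _ => ∅
  | top => ∅
  | bot => ∅
  | and A B => bv A ∪ bv B
  | or A B => bv A ∪ bv B
  | imp A B => bv A ∪ bv B
  | neg A => bv A
  | all x A => insert x (bv A)
  | ex x A => insert x (bv A)

/-- `rename a b F` replaces the free occurrences of variable `a` in `F` by variable `b`.
`F.rename a b` plays the role of "F(b)" when `F` is "F(a)". -/
def rename (a b : ℕ) : Formula → Formula
  | prop n => prop n
  | pred n x xs =>
      pred n (if x = a then b else x) (xs.map fun y => if y = a then b else y)
  | top => top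
  | bot => bot
  | and A B => and (rename a b A) (rename a b B)
  | or A B => or (rename a b A) (rename a b B)
  | imp A B => imp (rename a b A) (rename a b B)
  | neg A => neg (rename a b A)
  | all x A => if x = a then all x A else all x (rename a b A)
  | ex x A => if x = a then ex x A else ex x (rename a b A)

/-- A formula is propositional if it is built from propositional symbols (and ⊤, ⊥)
by the propositional connectives only. -/
def Propositional : Formula → Prop
  | prop _ => True
  | pred _ _ _ => False
  | top => True
  | bot => True
  | and A B => Propositional A ∧ Propositional B
  | or A B => Propositional A ∧ Propositional B
  | imp A B => Propositional A ∧ Propositional B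
  | neg A => Propositional A
  | all _ _ => False
  | ex _ _ => False

/-- A formula is purely predicate if all its atoms are built from predicate symbols
of arity > 0 (it contains no propositional symbols). -/
def PurelyPredicate : Formula → Prop
  | prop _ => False
  | pred _ _ _ => True
  | top => True
  | bot => True
  | and A B => PurelyPredicate A ∧ PurelyPredicate B
  | or A B => PurelyPredicate A ∧ PurelyPredicate B
  | imp A B => PurelyPredicate A ∧ PurelyPredicate B
  | neg A => PurelyPredicate A
  | all _ A => PurelyPredicate A
  | ex _ A => PurelyPredicate A

/-- Truth-table evaluation of a propositional formula under assignment `v`. -/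
def evalP (v : ℕ → Bool) : Formula → Bool
  | prop n => v n
  | pred _ _ _ => false
  | top => true
  | bot => false
  | and A B => evalP v A && evalP v B
  | or A B => evalP v A || evalP v B
  | imp A B => !evalP v A || evalP v B
  | neg A => !evalP v A
  | all _ _ => false
  | ex _ _ => false

/-- A (propositional) formula is classically valid / derivable in classical
propositional logic if it is true under every truth-value assignment. -/
def ClassicallyValid (A : Formula) : Prop := ∀ v : ℕ → Bool, evalP v A = true

/-- `substProp R C A` replaces all occurrences of the propositional symbol `R`
in `A` by the formula `C` (written A{R|C} in the paper). -/
def substProp (R : ℕ) (C : Formula) : Formula → Formula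
  | prop n => if n = R then C else prop n
  | pred n x xs => pred n x xs
  | top => top
  | bot => bot
  | and A B => and (substProp R C A) (substProp R C B)
  | or A B => or (substProp R C A) (substProp R C B)
  | imp A B => imp (substProp R C A) (substProp R C B)
  | neg A => neg (substProp R C A)
  | all x A => all x (substProp R C A)
  | ex x A => ex x (substProp R C A)

/-- `polProps b F` is the set of propositional symbols having an occurrence of
polarity `b` in `F` (`true` = positive, `false` = negative); `F` itself is a
positive occurrence, ∨ & quantifiers preserve polarity, ¬ flips it, and
`A ⊃ B` flips the polarity of `A` and preserves that of `B`. -/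
def polProps : Bool → Formula → Finset ℕ
  | b, prop n => if b then {n} else ∅
  | _, pred _ _ _ => ∅
  | _, top => ∅
  | _, bot => ∅
  | b, and A B => polProps b A ∪ polProps b B
  | b, or A B => polProps b A ∪ polProps b B
  | b, imp A B => polProps (!b) A ∪ polProps b B
  | b, neg A => polProps (!b) A
  | b, all _ A => polProps b A
  | b, ex _ A => polProps b A

/-- The propositional symbols occurring in a formula. -/
def propSyms (F : Formula) : Finset ℕ := polProps true F ∪ polProps false F

/-- A formula is unipolar if the occurrences of every propositional symbol in it
are either all positive or all negative. -/
def Unipolar (F : Formula) : Prop :=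
  ∀ n : ℕ, ¬ (n ∈ polProps true F ∧ n ∈ polProps false F)

end Formula

/-- A sequent Γ ⊢ Λ: the antecedent is a finite sequence of formulas and the
succedent contains at most one formula. -/
abbrev Sequent := List Formula × Option Formula

/-- Free variables of a list of formulas. -/
def fvList (Γ : List Formula) : Finset ℕ := Γ.foldr (fun A s => A.fv ∪ s) ∅

/-- Free variables of an optional succedent formula. -/
def fvOpt : Option Formula → Finset ℕ
  | none => ∅
  | some A => A.fv

/-- Inference rules (conclusion, list of premises) of Gentzen-style sequent calculi.
The flag `cut` enables the cut rule, the flag `neut` enables the neutralization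
rule (restricted to propositional formulas `N`), and `lem` determines the class of
formulas `A` for which the axiom `⊢ A ∨ ¬A` is available. -/
inductive Rule (cut neut : Bool) (lem : Formula → Prop) : Sequent → List Sequent → Prop
  | ax (A : Formula) : Rule cut neut lem ([A], some A) []
  | topR : Rule cut neut lem ([], some .top) []
  | botL : Rule cut neut lem ([.bot], none) []
  | thinL (A : Formula) (Γ : List Formula) (Λ : Option Formula) :
      Rule cut neut lem (A :: Γ, Λ) [(Γ, Λ)]
  | thinR (A : Formula) (Γ : List Formula) :
      Rule cut neut lem (Γ, some A) [(Γ, none)]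
  | contr (A : Formula) (Γ : List Formula) (Λ : Option Formula) :
      Rule cut neut lem (A :: Γ, Λ) [(A :: A :: Γ, Λ)]
  | exch (Δ Γ : List Formula) (A B : Formula) (Λ : Option Formula) :
      Rule cut neut lem (Δ ++ B :: A :: Γ, Λ) [(Δ ++ A :: B :: Γ, Λ)]
  | cut' (Γ Δ : List Formula) (C : Formula) (Λ : Option Formula) (hc : cut = true) :
      Rule cut neut lem (Γ ++ Δ, Λ) [(Γ, some C), (C :: Δ, Λ)]
  | andR (Γ : List Formula) (A B : Formula) :
      Rule cut neut lem (Γ, some (A.and B)) [(Γ, some A), (Γ, some B)]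
  | andL1 (A B : Formula) (Γ : List Formula) (Λ : Option Formula) :
      Rule cut neut lem (A.and B :: Γ, Λ) [(A :: Γ, Λ)]
  | andL2 (A B : Formula) (Γ : List Formula) (Λ : Option Formula) :
      Rule cut neut lem (A.and B :: Γ, Λ) [(B :: Γ, Λ)]
  | orL (A B : Formula) (Γ : List Formula) (Λ : Option Formula) :
      Rule cut neut lem (A.or B :: Γ, Λ) [(A :: Γ, Λ), (B :: Γ, Λ)]
  | orR1 (Γ : List Formula) (A B : Formula) :
      Rule cut neut lem (Γ, some (A.or B)) [(Γ, some A)]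
  | orR2 (Γ : List Formula) (A B : Formula) :
      Rule cut neut lem (Γ, some (A.or B)) [(Γ, some B)]
  | negR (A : Formula) (Γ : List Formula) :
      Rule cut neut lem (Γ, some A.neg) [(A :: Γ, none)]
  | negL (A : Formula) (Γ : List Formula) :
      Rule cut neut lem (A.neg :: Γ, none) [(Γ, some A)]
  | impR (A B : Formula) (Γ : List Formula) :
      Rule cut neut lem (Γ, some (A.imp B)) [(A :: Γ, some B)]
  | impL (A B : Formula) (Γ Δ : List Formula) (Λ : Option Formula) :
      Rule cut neut lem (A.imp B :: (Γ ++ Δ), Λ) [(Γ, some A), (B :: Δ, Λ)]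
  | allR (Γ : List Formula) (x a : ℕ) (G : Formula)
      (ha : a ∉ fvList Γ ∪ (Formula.all x G).fv) (hv : a ∉ G.vars) :
      Rule cut neut lem (Γ, some (.all x G)) [(Γ, some (G.rename x a))]
  | allL (x : ℕ) (G : Formula) (a : ℕ) (Γ : List Formula) (Λ : Option Formula)
      (hc : a = x ∨ a ∉ G.bv) :
      Rule cut neut lem (.all x G :: Γ, Λ) [(G.rename x a :: Γ, Λ)]
  | exR (Γ : List Formula) (x : ℕ) (G : Formula) (a : ℕ)
      (hc : a = x ∨ a ∉ G.bv) :
      Rule cut neut lem (Γ, some (.ex x G)) [(Γ, some (G.rename x a))]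
  | exL (x : ℕ) (G : Formula) (a : ℕ) (Γ : List Formula) (Λ : Option Formula)
      (ha : a ∉ (fvList Γ ∪ (Formula.ex x G).fv) ∪ fvOpt Λ) (hv : a ∉ G.vars) :
      Rule cut neut lem (.ex x G :: Γ, Λ) [(G.rename x a :: Γ, Λ)]
  | neut' (N : Formula) (Γ : List Formula) (Λ : Option Formula)
      (hn : neut = true) (hN : N.Propositional) :
      Rule cut neut lem (Γ, Λ) [(N :: Γ, Λ), (N.neg :: Γ, Λ)]
  | lemAx (A : Formula) (h : lem A) :
      Rule cut neut lem ([], some (A.or A.neg)) []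

/-- Derivability from a set of rules. -/
inductive Derives (R : Sequent → List Sequent → Prop) : Sequent → Prop
  | step {s : Sequent} {ps : List Sequent} :
      R s ps → (∀ p ∈ ps, Derives R p) → Derives R s

/-- No additional excluded-middle axioms. -/
def NoLem : Formula → Prop := fun _ => False

/-- LJ: Gentzen's intuitionistic sequent calculus. -/
def LJ : Sequent → Prop := Derives (Rule true false NoLem)

/-- LJ+: LJ extended with the neutralization rule. -/
def LJPlus : Sequent → Prop := Derives (Rule true true NoLem)

/-- Cut-free LJ+. -/
def LJPlusCF : Sequent → Prop := Derives (Rule false true NoLem)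

/-- LJ extended with the axiom schema ⊢ A ∨ ¬A for every propositional symbol A. -/
def LJLemPropAtoms : Sequent → Prop :=
  Derives (Rule true false (fun A => ∃ n : ℕ, A = Formula.prop n))

/-- LK: Gentzen's classical sequent calculus, presented equivalently as
LJ plus the axiom schema ⊢ A ∨ ¬A for arbitrary formulas A. -/
def LK : Sequent → Prop := Derives (Rule true false (fun _ => True))

/-- A formula is a theorem of LJ+ if the sequent ⊢ F is derivable. -/
def LJPlusThm (F : Formula) : Prop := LJPlus ([], some F)

def LJThm (F : Formula) : Prop := LJ ([], some F)

def LKThm (F : Formula) : Prop := LK ([], some F)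

/-- Intuitionistic Kripke structures: a partially ordered set of nodes with
monotone nonempty domains and monotone valuations for propositional symbols
and for predicate symbols. -/
structure Kripke where
  W : Type
  U : Type
  le : W → W → Prop
  le_refl : ∀ w, le w w
  le_trans : ∀ u v w, le u v → le v w → le u w
  le_antisymm : ∀ u v, le u v → le v u → u = v
  D : W → Set U
  D_ne : ∀ w, (D w).Nonempty
  D_mono : ∀ {w w'}, le w w' → D w ⊆ D w'
  TP : W → ℕ → Prop
  TQ : W → ℕ → List U → Prop
  TP_mono : ∀ {w w'}, le w w' → ∀ n, TP w n → TP w' n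
  TQ_mono : ∀ {w w'}, le w w' → ∀ n ds, TQ w n ds → TQ w' n ds

/-- A constrained Kripke structure: for all nodes k ≤ k' and every propositional
symbol Q, Q is in the valuation of k if and only if it is in the valuation of k'. -/
def Kripke.Constrained (K : Kripke) : Prop :=
  ∀ {w w' : K.W}, K.le w w' → ∀ n : ℕ, (K.TP w n ↔ K.TP w' n)

/-- The standard intuitionistic forcing relation (with an assignment σ of
domain elements to variables). -/
def Kripke.forces (K : Kripke) : K.W → (ℕ → K.U) → Formula → Prop
  | w, _, .prop n => K.TP w n
  | w, σ, .pred n x xs => K.TQ w n ((x :: xs).map σ)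
  | _, _, .top => True
  | _, _, .bot => False
  | w, σ, .and A B => K.forces w σ A ∧ K.forces w σ B
  | w, σ, .or A B => K.forces w σ A ∨ K.forces w σ B
  | w, σ, .imp A B => ∀ w', K.le w w' → K.forces w' σ A → K.forces w' σ B
  | w, σ, .neg A => ∀ w', K.le w w' → ¬ K.forces w' σ A
  | w, σ, .all x A => ∀ w', K.le w w' → ∀ d ∈ K.D w', K.forces w' (Function.update σ x d) A
  | w, σ, .ex x A => ∃ d ∈ K.D w, K.forces w (Function.update σ x d) A

/-- Validity of a sequent with respect to constrained Kripke structures: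
at every node of every constrained Kripke structure (under every assignment into
the node's domain), either some antecedent formula is not forced, or the
succedent is nonempty and its formula is forced. -/
def SeqValid (s : Sequent) : Prop :=
  ∀ K : Kripke, K.Constrained → ∀ w : K.W, ∀ σ : ℕ → K.U, (∀ n, σ n ∈ K.D w) →
    (∃ A ∈ s.1, ¬ K.forces w σ A) ∨ (∃ A, s.2 = some A ∧ K.forces w σ A)

/-- A calculus in which every rule of `R` is derivable derives whatever `R` derives. -/
theorem Derives.mono {R R' : Sequent → List Sequent → Prop}
    (h : ∀ s ps, R s ps → (∀ p ∈ ps, Derives R' p) → Derives R' s) {s : Sequent}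
    (hs : Derives R s) : Derives R' s := by
  induction hs with
  | step hr _ ih => exact h _ _ hr ih

theorem Derives.step₁ {R : Sequent → List Sequent → Prop} {s p : Sequent} (hr : R s [p])
    (hp : Derives R p) : Derives R s :=
  .step hr (by simpa using hp)

theorem Derives.step₂ {R : Sequent → List Sequent → Prop} {s p q : Sequent} (hr : R s [p, q])
    (hp : Derives R p) (hq : Derives R q) : Derives R s :=
  .step hr (by simpa using ⟨hp, hq⟩)

/-- Rules of one calculus are derivable in another with at least as many cuts, provided that
neutralization and the excluded-middle axioms are. -/
theorem Rule.derives_of {cut neut neut' : Bool} {lem lem' : Formula → Prop}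
    (hneut : neut = true → ∀ N : Formula, N.Propositional → ∀ Γ Λ,
      Derives (Rule cut neut' lem') (N :: Γ, Λ) → Derives (Rule cut neut' lem') (N.neg :: Γ, Λ) →
      Derives (Rule cut neut' lem') (Γ, Λ))
    (hlem : ∀ A, lem A → Derives (Rule cut neut' lem') ([], some (A.or A.neg)))
    {s : Sequent} {ps : List Sequent} (hr : Rule cut neut lem s ps)
    (hps : ∀ p ∈ ps, Derives (Rule cut neut' lem') p) : Derives (Rule cut neut' lem') s := by
  cases hr with
  | neut' N Γ Λ hn hN => exact hneut hn N hN Γ Λ (hps _ (by simp)) (hps _ (by simp))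
  | lemAx A h => exact hlem A h
  | cut' _ _ _ _ hc => exact .step (.cut' _ _ _ _ hc) hps
  | allR _ _ _ _ ha hv => exact .step (.allR _ _ _ _ ha hv) hps
  | allL _ _ _ _ _ hc => exact .step (.allL _ _ _ _ _ hc) hps
  | exR _ _ _ _ hc => exact .step (.exR _ _ _ _ hc) hps
  | exL _ _ _ _ _ ha hv => exact .step (.exL _ _ _ _ _ ha hv) hps
  | _ => exact .step (by constructor) hps

namespace Derives

variable {cut neut : Bool} {lem : Formula → Prop}

theorem perm_append {Γ Γ' : List Formula} {Λ : Option Formula} (h : Γ.Perm Γ')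
    (Δ : List Formula) (hd : Derives (Rule cut neut lem) (Δ ++ Γ, Λ)) :
    Derives (Rule cut neut lem) (Δ ++ Γ', Λ) := by
  induction h generalizing Δ with
  | nil => exact hd
  | cons A _ ih => simpa using ih (Δ ++ [A]) (by simpa using hd)
  | swap A B Γ => exact step₁ (.exch _ _ _ _ _) hd
  | trans _ _ ih₁ ih₂ => exact ih₂ Δ (ih₁ Δ hd)

theorem perm {Γ Γ' : List Formula} {Λ : Option Formula} (h : Γ.Perm Γ')
    (hd : Derives (Rule cut neut lem) (Γ, Λ)) : Derives (Rule cut neut lem) (Γ', Λ) :=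
  perm_append h [] hd

theorem thin_append {Γ : List Formula} {Λ : Option Formula} (Δ : List Formula)
    (hd : Derives (Rule cut neut lem) (Γ, Λ)) : Derives (Rule cut neut lem) (Δ ++ Γ, Λ) := by
  induction Δ with
  | nil => exact hd
  | cons A Δ ih => exact step₁ (.thinL _ _ _) ih

theorem contr_append {Γ Δ : List Formula} {Λ : Option Formula} (h : Δ ⊆ Γ)
    (hd : Derives (Rule cut neut lem) (Δ ++ Γ, Λ)) : Derives (Rule cut neut lem) (Γ, Λ) := by
  induction Δ with
  | nil => exact hd
  | cons A Δ ih =>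
    obtain ⟨hA, hΔ⟩ := List.cons_subset.1 h
    have hp : (Δ ++ Γ).Perm (A :: (Δ ++ Γ).erase A) :=
      List.perm_cons_erase (List.mem_append_right _ hA)
    exact ih hΔ (perm hp.symm (step₁ (.contr _ _ _) (perm (hp.cons A) hd)))

theorem weaken {Γ Γ' : List Formula} {Λ : Option Formula} (h : Γ ⊆ Γ')
    (hd : Derives (Rule cut neut lem) (Γ, Λ)) : Derives (Rule cut neut lem) (Γ', Λ) :=
  contr_append h (perm List.perm_append_comm (thin_append Γ' hd))

theorem hyp {A : Formula} {Γ : List Formula} (h : A ∈ Γ) :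
    Derives (Rule cut neut lem) (Γ, some A) :=
  weaken (Γ := [A]) (by simpa using h) (step (.ax A) (by simp))

theorem exfalso {Γ : List Formula} {Λ : Option Formula}
    (h : Derives (Rule cut neut lem) (Γ, none)) : Derives (Rule cut neut lem) (Γ, Λ) := by
  cases Λ with
  | none => exact h
  | some A => exact step₁ (.thinR _ _) h

theorem absurd {A : Formula} {Γ : List Formula} {Λ : Option Formula} (hA : A ∈ Γ)
    (hn : A.neg ∈ Γ) : Derives (Rule cut neut lem) (Γ, Λ) :=
  exfalso (weaken (List.cons_subset.2 ⟨hn, List.Subset.refl Γ⟩) (step₁ (.negL A Γ) (hyp hA)))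

theorem neut_of_em {N : Formula} {Γ : List Formula} {Λ : Option Formula}
    (hem : Derives (Rule true neut lem) ([], some (N.or N.neg)))
    (h₁ : Derives (Rule true neut lem) (N :: Γ, Λ))
    (h₂ : Derives (Rule true neut lem) (N.neg :: Γ, Λ)) : Derives (Rule true neut lem) (Γ, Λ) :=
  step₂ (.cut' [] Γ _ Λ rfl) hem (step₂ (.orL _ _ _ _) h₁ h₂)

theorem em_of_pos {N : Formula} {Γ : List Formula}
    (h : Derives (Rule cut neut lem) (Γ, some N)) :
    Derives (Rule cut neut lem) (Γ, some (N.or N.neg)) :=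
  step₁ (.orR1 _ _ _) h

theorem em_of_neg {N : Formula} {Γ : List Formula}
    (h : Derives (Rule cut neut lem) (N :: Γ, none)) :
    Derives (Rule cut neut lem) (Γ, some (N.or N.neg)) :=
  step₁ (.orR2 _ _ _) (step₁ (.negR _ _) h)

/-- Excluded middle for propositional symbols yields it for all propositional formulas. -/
theorem em_of_propositional
    (hprop : ∀ n, Derives (Rule true neut lem) ([], some ((Formula.prop n).or (.neg (.prop n)))))
    {N : Formula} (hN : N.Propositional) :
    Derives (Rule true neut lem) ([], some (N.or N.neg)) := by
  induction N with
  | prop n => exact hprop n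
  | pred => exact hN.elim
  | all => exact hN.elim
  | ex => exact hN.elim
  | top => exact em_of_pos (step .topR (by simp))
  | bot => exact em_of_neg (step .botL (by simp))
  | neg A ihA =>
    refine neut_of_em (ihA hN) (em_of_neg ?_) (em_of_pos (hyp (by simp)))
    exact absurd (A := A) (by simp) (by simp)
  | and A B ihA ihB =>
    refine neut_of_em (ihA hN.1) (neut_of_em (weaken (by simp) (ihB hN.2)) ?_ ?_) ?_
    · exact em_of_pos (step₂ (.andR _ _ _) (hyp (by simp)) (hyp (by simp)))
    · exact em_of_neg (step₁ (.andL2 _ _ _ _) (absurd (A := B) (by simp) (by simp)))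
    · exact em_of_neg (step₁ (.andL1 _ _ _ _) (absurd (A := A) (by simp) (by simp)))
  | or A B ihA ihB =>
    refine neut_of_em (ihA hN.1) ?_ (neut_of_em (weaken (by simp) (ihB hN.2)) ?_ ?_)
    · exact em_of_pos (step₁ (.orR1 _ _ _) (hyp (by simp)))
    · exact em_of_pos (step₁ (.orR2 _ _ _) (hyp (by simp)))
    · exact em_of_neg (step₂ (.orL _ _ _ _) (absurd (A := A) (by simp) (by simp))
        (absurd (A := B) (by simp) (by simp)))
  | imp A B ihA ihB =>
    refine neut_of_em (ihA hN.1) (neut_of_em (weaken (by simp) (ihB hN.2)) ?_ ?_) ?_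
    · exact em_of_pos (step₁ (.impR _ _ _) (hyp (by simp)))
    · refine em_of_neg (weaken (Γ := A.imp B :: ([A] ++ [B.neg])) (by simp) ?_)
      exact step₂ (.impL _ _ _ _ _) (hyp (by simp)) (absurd (A := B) (by simp) (by simp))
    · exact em_of_pos (step₁ (.impR _ _ _) (absurd (A := A) (by simp) (by simp)))

end Derives

/-- Excluded middle for a propositional formula is derivable by neutralization. -/
theorem LJPlusThm.em {N : Formula} (hN : N.Propositional) : LJPlusThm (N.or N.neg) :=
  .step₂ (.neut' N _ _ rfl hN) (.em_of_pos (.hyp (by simp)))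
    (.step₁ (.orR2 _ _ _) (.hyp (by simp)))

/-- LJ+ (LJ with the neutralization rule) derives exactly the same
sequents as LJ extended with the axiom schema ⊢ A ∨ ¬A for every propositional
symbol A; in particular ⊢ N ∨ ¬N is derivable in LJ+ for every propositional symbol N. -/
theorem ljplus_eq_lj_with_prop_lem :
    (∀ s : Sequent, LJPlus s ↔ LJLemPropAtoms s) ∧
    (∀ n : ℕ, LJPlusThm ((Formula.prop n).or (Formula.prop n).neg)) := by
  refine ⟨fun s => ⟨Derives.mono fun _ _ => ?_, Derives.mono fun _ _ => ?_⟩,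
    fun n => LJPlusThm.em trivial⟩
  · refine Rule.derives_of (fun _ N hN Γ Λ => Derives.neut_of_em ?_) fun _ => False.elim
    exact Derives.em_of_propositional (fun n => .step (.lemAx _ ⟨n, rfl⟩) (by simp)) hN
  · refine Rule.derives_of (fun h => by simp at h) ?_
    rintro _ ⟨n, rfl⟩
    exact LJPlusThm.em trivial
end

section
/- The propositional fragment of LJ+ coincides with classical propositional logic: a propositional formula is derivable in LJ+ if and only if it is derivable in classical propositional logic. -/
namespace Formula

/-- Evaluation over a one-element domain on which every predicate is false. -/
def evalTrivial (v : ℕ → Bool) : Formula → Bool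
  | prop n => v n
  | pred _ _ _ => false
  | top => true
  | bot => false
  | and A B => evalTrivial v A && evalTrivial v B
  | or A B => evalTrivial v A || evalTrivial v B
  | imp A B => !evalTrivial v A || evalTrivial v B
  | neg A => !evalTrivial v A
  | all _ A => evalTrivial v A
  | ex _ A => evalTrivial v A

theorem evalTrivial_rename (v : ℕ → Bool) (a b : ℕ) (A : Formula) :
    (A.rename a b).evalTrivial v = A.evalTrivial v := by
  induction A with
  | all x A ih | ex x A ih => by_cases h : x = a <;> simp [rename, evalTrivial, h, ih]
  | _ => simp_all [rename, evalTrivial]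

theorem evalTrivial_eq_evalP (v : ℕ → Bool) {A : Formula} (hA : A.Propositional) :
    A.evalTrivial v = A.evalP v := by
  induction A <;> simp_all [Propositional, evalTrivial, evalP]

end Formula

namespace LJPlus

theorem sound {s : Sequent} (h : LJPlus s) (v : ℕ → Bool)
    (hs : ∀ A ∈ s.1, A.evalTrivial v = true) : ∃ A, s.2 = some A ∧ A.evalTrivial v = true := by
  induction h with
  | step hr _ ih =>
    cases hr with
    | lemAx A h => exact h.elim
    | cut' Γ Δ C Λ =>
      simp only [List.mem_cons, List.not_mem_nil, or_false, forall_eq,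
        List.mem_append, or_imp, forall_and, Option.some.injEq, exists_eq_left'] at ih hs
      exact ih.2 ⟨ih.1 hs.1, hs.2⟩
    | neut' N Γ Λ =>
      cases hN : N.evalTrivial v <;> simp_all [Formula.evalTrivial]
    | impL A B Γ Δ Λ =>
      simp only [List.mem_cons, List.not_mem_nil, or_false, forall_eq,
        List.mem_append, or_imp, forall_and, Option.some.injEq, exists_eq_left'] at ih hs
      have hA := ih.1 hs.2.1
      exact ih.2 ⟨by simpa [Formula.evalTrivial, hA] using hs.1, hs.2.2⟩
    | impR A B Γ =>
      cases hA : A.evalTrivial v <;> simp_all [Formula.evalTrivial]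
    | negR A Γ =>
      cases hA : A.evalTrivial v <;> simp_all [Formula.evalTrivial]
    | exch Δ Γ A B Λ =>
      refine ih (Δ ++ A :: B :: Γ, Λ) (List.mem_singleton_self _) fun C hC => hs C <| by
        simp only [List.mem_append, List.mem_cons] at hC ⊢; tauto
    | orL A B Γ Λ =>
      cases hA : A.evalTrivial v <;> simp_all [Formula.evalTrivial]
    | _ => simp_all [Formula.evalTrivial, Formula.evalTrivial_rename]

theorem of_rule₀ {s : Sequent} (h : Rule true true NoLem s []) : LJPlus s :=
  .step h (by simp)

theorem of_rule₁ {s p : Sequent} (h : Rule true true NoLem s [p]) (hp : LJPlus p) : LJPlus s :=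
  .step h (List.forall_mem_singleton.2 hp)

theorem of_rule₂ {s p q : Sequent} (h : Rule true true NoLem s [p, q])
    (hp : LJPlus p) (hq : LJPlus q) : LJPlus s :=
  .step h (List.forall_mem_cons.2 ⟨hp, List.forall_mem_singleton.2 hq⟩)

theorem perm_append {Γ Γ' : List Formula} (h : Γ.Perm Γ') (Δ : List Formula)
    {Λ : Option Formula} (hd : LJPlus (Δ ++ Γ, Λ)) : LJPlus (Δ ++ Γ', Λ) := by
  induction h generalizing Δ with
  | nil => exact hd
  | cons a _ ih => simpa using ih (Δ ++ [a]) (by simpa using hd)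
  | swap a b l => exact of_rule₁ (.exch Δ l b a Λ) hd
  | trans _ _ ih₁ ih₂ => exact ih₂ Δ (ih₁ Δ hd)

theorem perm {Γ Γ' : List Formula} (h : Γ.Perm Γ') {Λ : Option Formula}
    (hd : LJPlus (Γ, Λ)) : LJPlus (Γ', Λ) :=
  perm_append h [] hd

theorem contract_of_mem {A : Formula} {Γ : List Formula} (hA : A ∈ Γ) {Λ : Option Formula}
    (h : LJPlus (A :: Γ, Λ)) : LJPlus (Γ, Λ) := by
  have hp := List.perm_cons_erase hA
  exact perm hp.symm (of_rule₁ (.contr A _ Λ) (perm (hp.cons A) h))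

theorem weaken_append (Δ : List Formula) {Γ : List Formula} {Λ : Option Formula}
    (h : LJPlus (Γ, Λ)) : LJPlus (Δ ++ Γ, Λ) := by
  induction Δ with
  | nil => exact h
  | cons A Δ ih => exact of_rule₁ (.thinL A _ Λ) ih

theorem contract_append {Δ Γ : List Formula} (hs : Δ ⊆ Γ) {Λ : Option Formula}
    (h : LJPlus (Δ ++ Γ, Λ)) : LJPlus (Γ, Λ) := by
  induction Δ with
  | nil => exact h
  | cons A Δ ih =>
    rw [List.cons_subset] at hs
    exact ih hs.2 (contract_of_mem (List.mem_append_right _ hs.1) h)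

theorem mono {Γ Γ' : List Formula} (hs : Γ ⊆ Γ') {Λ : Option Formula}
    (h : LJPlus (Γ, Λ)) : LJPlus (Γ', Λ) :=
  contract_append hs (perm List.perm_append_comm (weaken_append Γ' h))

/-- `Decides Γ b A`: the context `Γ` proves `A` if `b` is true, and refutes `A` otherwise. -/
def Decides (Γ : List Formula) (b : Bool) (A : Formula) : Prop :=
  if b then LJPlus (Γ, some A) else LJPlus (A :: Γ, none)

/-- Kalmár's lemma: a context deciding all symbols of `A` decides `A`. -/
theorem decides_evalP {Γ : List Formula} {v : ℕ → Bool} {A : Formula} (hA : A.Propositional)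
    (h : ∀ n ∈ A.propSyms, Decides Γ (v n) (.prop n)) : Decides Γ (A.evalP v) A := by
  induction A with
  | prop n => exact h n (by simp [Formula.propSyms, Formula.polProps])
  | pred | all | ex => exact hA.elim
  | top => exact mono (List.nil_subset _) (of_rule₀ .topR)
  | bot => exact mono (by simp) (of_rule₀ .botL)
  | and A B ihA ihB =>
    have dA := ihA hA.1 fun n hn => h n <| by
      simp only [Formula.propSyms, Formula.polProps, Finset.mem_union] at hn ⊢; tauto
    have dB := ihB hA.2 fun n hn => h n <| by
      simp only [Formula.propSyms, Formula.polProps, Finset.mem_union] at hn ⊢; tauto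
    cases eA : A.evalP v <;> cases eB : B.evalP v <;>
      simp only [Decides, Formula.evalP, eA, eB, Bool.and_true, Bool.and_false, if_true,
        Bool.false_eq_true, if_false] at dA dB ⊢
    · exact of_rule₁ (.andL1 ..) dA
    · exact of_rule₁ (.andL1 ..) dA
    · exact of_rule₁ (.andL2 ..) dB
    · exact of_rule₂ (.andR ..) dA dB
  | or A B ihA ihB =>
    have dA := ihA hA.1 fun n hn => h n <| by
      simp only [Formula.propSyms, Formula.polProps, Finset.mem_union] at hn ⊢; tauto
    have dB := ihB hA.2 fun n hn => h n <| by
      simp only [Formula.propSyms, Formula.polProps, Finset.mem_union] at hn ⊢; tauto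
    cases eA : A.evalP v <;> cases eB : B.evalP v <;>
      simp only [Decides, Formula.evalP, eA, eB, Bool.or_true, Bool.or_false, if_true,
        Bool.false_eq_true, if_false] at dA dB ⊢
    · exact of_rule₂ (.orL ..) dA dB
    · exact of_rule₁ (.orR2 ..) dB
    · exact of_rule₁ (.orR1 ..) dA
    · exact of_rule₁ (.orR1 ..) dA
  | imp A B ihA ihB =>
    have dA := ihA hA.1 fun n hn => h n <| by
      simp only [Formula.propSyms, Formula.polProps, Finset.mem_union, Bool.not_true,
        Bool.not_false] at hn ⊢; tauto
    have dB := ihB hA.2 fun n hn => h n <| by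
      simp only [Formula.propSyms, Formula.polProps, Finset.mem_union] at hn ⊢; tauto
    cases eA : A.evalP v <;> cases eB : B.evalP v <;>
      simp only [Decides, Formula.evalP, eA, eB, Bool.or_true, Bool.or_false, if_true,
        Bool.not_true, Bool.not_false, Bool.false_eq_true, if_false] at dA dB ⊢
    · exact of_rule₁ (.impR ..) (of_rule₁ (.thinR ..) dA)
    · exact of_rule₁ (.impR ..) (of_rule₁ (.thinL ..) dB)
    · exact mono (by simp) (of_rule₂ (.impL A B Γ Γ none) dA dB)
    · exact of_rule₁ (.impR ..) (of_rule₁ (.thinL ..) dB)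
  | neg A ih =>
    have dA := ih hA fun n hn => h n <| by
      simp only [Formula.propSyms, Formula.polProps, Finset.mem_union, Bool.not_true,
        Bool.not_false] at hn ⊢; tauto
    cases eA : A.evalP v <;>
      simp only [Decides, Formula.evalP, eA, if_true, Bool.not_true, Bool.not_false,
        Bool.false_eq_true, if_false] at dA ⊢
    · exact of_rule₁ (.negR ..) dA
    · exact of_rule₁ (.negL ..) dA

theorem of_classicallyValid {A : Formula} (hA : A.Propositional) (hv : A.ClassicallyValid)
    (S : List ℕ) (Γ : List Formula)
    (h : ∀ n ∈ A.propSyms, n ∈ S ∨ .prop n ∈ Γ ∨ .neg (.prop n) ∈ Γ) :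
    LJPlus (Γ, some A) := by
  induction S generalizing Γ with
  | nil =>
    have key : Decides Γ (A.evalP fun n => decide (Formula.prop n ∈ Γ)) A := by
      refine decides_evalP hA fun n hn => ?_
      by_cases hp : Formula.prop n ∈ Γ
      · simpa [Decides, hp] using mono (by simpa using hp) (of_rule₀ (.ax (.prop n)))
      · have hneg : Formula.neg (.prop n) ∈ Γ := by simpa [hp] using h n hn
        simpa [Decides, hp] using
          mono (by simp [hneg]) (of_rule₁ (.negL (.prop n) [.prop n]) (of_rule₀ (.ax _)))
    simpa [Decides, hv _] using key
  | cons m S ih =>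
    refine of_rule₂ (.neut' (.prop m) Γ _ rfl trivial) (ih _ fun n hn => ?_) (ih _ fun n hn => ?_)
    all_goals
      have := h n hn
      simp only [List.mem_cons, Formula.prop.injEq, Formula.neg.injEq] at this ⊢
      tauto

end LJPlus

/-- the propositional fragment of LJ+ coincides with classical
propositional logic: a propositional formula is derivable in LJ+ iff it is
true under every truth-value assignment. -/
theorem ljplus_propositional_fragment_classical (F : Formula) (hF : F.Propositional) :
    LJPlusThm F ↔ F.ClassicallyValid := by
  refine ⟨fun h v => ?_, fun h => ?_⟩
  · simpa [Formula.evalTrivial_eq_evalP v hF] using LJPlus.sound h v (by simp)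
  · exact LJPlus.of_classicallyValid hF h F.propSyms.toList [] (by simp)
end

section
/- There exist formulas derivable in LJ+ but not derivable in LJ: for a propositional symbol R and a unary predicate symbol P, the formula (R ∨ ¬R) ∨ P(x) is derivable in LJ+ but not derivable in LJ. -/
namespace Formula

/-- The value of a formula in a Heyting algebra, where the propositional symbols are valued by `v`,
all predicate atoms are false, and quantifiers are ignored (as over a one-element domain). -/
def heytingEval {H : Type*} [HeytingAlgebra H] (v : ℕ → H) : Formula → H
  | prop n => v n
  | pred _ _ _ => ⊥
  | top => ⊤
  | bot => ⊥
  | and A B => heytingEval v A ⊓ heytingEval v B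
  | or A B => heytingEval v A ⊔ heytingEval v B
  | imp A B => heytingEval v A ⇨ heytingEval v B
  | neg A => (heytingEval v A)ᶜ
  | all _ A => heytingEval v A
  | ex _ A => heytingEval v A

theorem heytingEval_rename {H : Type*} [HeytingAlgebra H] (v : ℕ → H) (a b : ℕ) (A : Formula) :
    (A.rename a b).heytingEval v = A.heytingEval v := by
  induction A <;> simp_all only [rename, heytingEval] <;> split_ifs <;> simp_all only [heytingEval]

end Formula

/-- A sequent holds in a Heyting algebra if every lower bound of the values of the antecedent
formulas lies below the value of the succedent. -/
def HeytingValid {H : Type*} [HeytingAlgebra H] (v : ℕ → H) (s : Sequent) : Prop :=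
  ∀ c : H, (∀ A ∈ s.1, c ≤ A.heytingEval v) → c ≤ s.2.elim ⊥ (Formula.heytingEval v)

theorem heytingValid_cons {H : Type*} [HeytingAlgebra H] {v : ℕ → H} {A : Formula}
    {Γ : List Formula} {Λ : Option Formula} :
    HeytingValid v (A :: Γ, Λ) ↔ ∀ c : H, (∀ B ∈ Γ, c ≤ B.heytingEval v) →
      c ⊓ A.heytingEval v ≤ Λ.elim ⊥ (Formula.heytingEval v) := by
  constructor
  · intro h c hc
    refine h _ fun B hB => ?_
    rcases List.mem_cons.1 hB with rfl | hB
    · exact inf_le_right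
    · exact inf_le_left.trans (hc B hB)
  · intro h c hc
    have := h c fun B hB => hc B (List.mem_cons_of_mem _ hB)
    rwa [inf_eq_left.2 (hc A List.mem_cons_self)] at this

theorem Rule.heytingValid {H : Type*} [HeytingAlgebra H] (v : ℕ → H) {cut : Bool} {s : Sequent}
    {ps : List Sequent} (hr : Rule cut false NoLem s ps) (hp : ∀ p ∈ ps, HeytingValid v p) :
    HeytingValid v s := by
  cases hr with
  | ax A => exact fun c hc => hc A List.mem_cons_self
  | topR => exact fun c _ => le_top
  | botL => exact fun c hc => hc .bot List.mem_cons_self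
  | thinL A Γ Λ =>
    exact fun c hc => hp _ List.mem_cons_self c fun B hB => hc B (List.mem_cons_of_mem _ hB)
  | thinR A Γ => exact fun c hc => (hp _ List.mem_cons_self c hc).trans bot_le
  | contr A Γ Λ =>
    exact fun c hc => hp _ List.mem_cons_self c fun B hB => hc B (by simpa using hB)
  | exch Δ Γ A B Λ =>
    exact fun c hc => hp _ List.mem_cons_self c fun C hC => hc C
      (((List.Perm.swap B A Γ).append_left Δ).mem_iff.1 hC)
  | cut' Γ Δ C Λ _ =>
    simp only [List.forall_mem_cons, heytingValid_cons] at hp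
    obtain ⟨h₁, h₂, -⟩ := hp
    intro c hc
    have hC := h₁ c fun B hB => hc B (List.mem_append_left _ hB)
    have hΛ := h₂ c fun B hB => hc B (List.mem_append_right _ hB)
    exact (le_inf le_rfl hC).trans hΛ
  | andR Γ A B =>
    simp only [List.forall_mem_cons] at hp
    exact fun c hc => le_inf (hp.1 c hc) (hp.2.1 c hc)
  | andL1 A B Γ Λ =>
    simp only [List.forall_mem_cons, heytingValid_cons] at hp ⊢
    exact fun c hc => (inf_le_inf_left c inf_le_left).trans (hp.1 c hc)
  | andL2 A B Γ Λ =>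
    simp only [List.forall_mem_cons, heytingValid_cons] at hp ⊢
    exact fun c hc => (inf_le_inf_left c inf_le_right).trans (hp.1 c hc)
  | orL A B Γ Λ =>
    simp only [List.forall_mem_cons, heytingValid_cons] at hp ⊢
    exact fun c hc => inf_sup_left c _ _ |>.trans_le (sup_le (hp.1 c hc) (hp.2.1 c hc))
  | orR1 Γ A B => exact fun c hc => (hp _ List.mem_cons_self c hc).trans le_sup_left
  | orR2 Γ A B => exact fun c hc => (hp _ List.mem_cons_self c hc).trans le_sup_right
  | negR A Γ =>
    simp only [List.forall_mem_cons, heytingValid_cons] at hp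
    exact fun c hc => le_compl_iff_disjoint_right.2 (disjoint_iff_inf_le.2 (hp.1 c hc))
  | negL A Γ =>
    rw [heytingValid_cons]
    exact fun c hc => (inf_le_inf_right _ (hp _ List.mem_cons_self c hc)).trans
      (inf_compl_self _).le
  | impR A B Γ =>
    simp only [List.forall_mem_cons, heytingValid_cons] at hp
    exact fun c hc => le_himp_iff.2 (hp.1 c hc)
  | impL A B Γ Δ Λ =>
    simp only [List.forall_mem_cons, heytingValid_cons] at hp ⊢
    obtain ⟨h₁, h₂, -⟩ := hp
    intro c hc
    have hA := h₁ c fun B hB => hc B (List.mem_append_left _ hB)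
    have hΛ := h₂ c fun B hB => hc B (List.mem_append_right _ hB)
    exact (le_inf inf_le_left ((inf_le_inf_right _ hA).trans inf_himp_le)).trans hΛ
  | allR Γ y a G _ _ | exR Γ y G a _ =>
    intro c hc
    have := hp _ List.mem_cons_self c hc
    rwa [Option.elim_some, Formula.heytingEval_rename] at this
  | allL y G a Γ Λ _ | exL y G a Γ Λ _ _ =>
    simp only [List.forall_mem_cons, heytingValid_cons, Formula.heytingEval_rename] at hp ⊢
    exact hp.1
  | neut' N Γ Λ hn _ => exact absurd hn Bool.false_ne_true
  | lemAx A h => exact h.elim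

theorem LJ.heytingValid {H : Type*} [HeytingAlgebra H] (v : ℕ → H) {s : Sequent} (h : LJ s) :
    HeytingValid v s := by
  induction h with
  | step hr _ ih => exact hr.heytingValid v ih

theorem LJPlusThm.prop_em_or (N B : Formula) (hN : N.Propositional) :
    LJPlusThm ((N.or N.neg).or B) := by
  refine .step (.neut' N _ _ rfl hN) (List.forall_mem_cons.2 ⟨?_, List.forall_mem_singleton.2 ?_⟩)
  · refine .step (.orR1 _ _ _) (List.forall_mem_singleton.2 ?_)
    exact .step (.orR1 _ _ _) (List.forall_mem_singleton.2 (.step (.ax _) (by simp)))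
  · refine .step (.orR1 _ _ _) (List.forall_mem_singleton.2 ?_)
    exact .step (.orR2 _ _ _) (List.forall_mem_singleton.2 (.step (.ax _) (by simp)))

/-- for a propositional symbol R and a unary predicate symbol P, the
formula (R ∨ ¬R) ∨ P(x) is derivable in LJ+ but not derivable in LJ. -/
theorem ljplus_proper_extension_of_lj (R P x : ℕ) :
    LJPlusThm (((Formula.prop R).or (Formula.prop R).neg).or (Formula.pred P x [])) ∧
    ¬ LJThm (((Formula.prop R).or (Formula.prop R).neg).or (Formula.pred P x [])) := by
  refine ⟨LJPlusThm.prop_em_or _ _ trivial, fun h => ?_⟩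
  have hv := LJ.heytingValid (fun _ => (1 : ℕ∞)) h ⊤ (by simp)
  have hc : (1 : ℕ∞)ᶜ = ⊥ :=
    (min_eq_bot.1 (inf_compl_self (1 : ℕ∞))).resolve_left (by simp)
  simp [Formula.heytingEval, hc] at hv
end

section
/- Subformula property for predicate formulas: in any cut-free LJ+ derivation, every non-propositional formula occurring in the derivation is a subformula of some formula of the endsequent. -/
/-- Derivation trees labeled by sequents. -/
inductive DTree : Type
  | node : Sequent → List DTree → DTree

/-- The endsequent (root label) of a derivation tree. -/
def DTree.root : DTree → Sequent
  | .node s _ => s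

/-- A correct cut-free LJ+ derivation: every node is an instance of a rule of
LJ+ other than cut, with the roots of its subtrees as premises. -/
inductive DTree.Correct : DTree → Prop
  | node (s : Sequent) (ts : List DTree)
      (hr : Rule false true NoLem s (ts.map DTree.root))
      (ht : ∀ t ∈ ts, DTree.Correct t) : DTree.Correct (.node s ts)

/-- The sequent `q` occurs in the derivation tree. -/
inductive DTree.SeqIn (q : Sequent) : DTree → Prop
  | here (ts : List DTree) : DTree.SeqIn q (.node q ts)
  | there (s : Sequent) (ts : List DTree) (t : DTree) (ht : t ∈ ts)
      (h : DTree.SeqIn q t) : DTree.SeqIn q (.node s ts)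

/-- The subformula relation (subformulas of quantified formulas include their
instances obtained by renaming the bound variable to any variable). -/
inductive Subf : Formula → Formula → Prop
  | refl (A : Formula) : Subf A A
  | andl {F A B : Formula} : Subf F A → Subf F (A.and B)
  | andr {F A B : Formula} : Subf F B → Subf F (A.and B)
  | orl {F A B : Formula} : Subf F A → Subf F (A.or B)
  | orr {F A B : Formula} : Subf F B → Subf F (A.or B)
  | impl {F A B : Formula} : Subf F A → Subf F (A.imp B)
  | impr {F A B : Formula} : Subf F B → Subf F (A.imp B)
  | negs {F A : Formula} : Subf F A → Subf F A.neg
  | alls {F G : Formula} {x a : ℕ} : Subf F (G.rename x a) → Subf F (Formula.all x G)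
  | exs {F G : Formula} {x a : ℕ} : Subf F (G.rename x a) → Subf F (Formula.ex x G)

theorem Subf.trans {F A B : Formula} (h₁ : Subf F A) (h₂ : Subf A B) : Subf F B := by
  induction h₂ with
  | refl => exact h₁
  | andl _ ih => exact .andl ih
  | andr _ ih => exact .andr ih
  | orl _ ih => exact .orl ih
  | orr _ ih => exact .orr ih
  | impl _ ih => exact .impl ih
  | impr _ ih => exact .impr ih
  | negs _ ih => exact .negs ih
  | alls _ ih => exact .alls ih
  | exs _ ih => exact .exs ih

theorem Subf.propositional {F A : Formula} (h : Subf F A) (hA : A.Propositional) :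
    F.Propositional := by
  induction h with
  | refl => exact hA
  | andl _ ih | orl _ ih | impl _ ih => exact ih hA.1
  | andr _ ih | orr _ ih | impr _ ih => exact ih hA.2
  | negs _ ih => exact ih hA
  | alls _ _ | exs _ _ => exact hA.elim

/-- In a cut-free rule, every non-propositional formula of a premise is a subformula of some
formula of the conclusion. -/
theorem Rule.exists_subf_of_mem_premise {neut : Bool} {lem : Formula → Prop} {s p : Sequent}
    {ps : List Sequent} (hr : Rule false neut lem s ps) (hp : p ∈ ps) {F : Formula}
    (hF : F ∈ p.1 ∨ p.2 = some F) (hnp : ¬ F.Propositional) :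
    ∃ G : Formula, (G ∈ s.1 ∨ s.2 = some G) ∧ Subf F G := by
  have keep (h : F ∈ s.1 ∨ s.2 = some F) :
      ∃ G : Formula, (G ∈ s.1 ∨ s.2 = some G) ∧ Subf F G := ⟨F, h, .refl F⟩
  cases hr with
  | ax | topR | botL | lemAx => simp at hp
  | cut' _ _ _ _ hc => simp at hc
  | thinL | thinR | contr | exch =>
    simp only [List.mem_singleton] at hp
    subst hp
    apply keep
    simp at hF ⊢
    tauto
  | neut' N Γ Λ hn hN =>
    simp only [List.mem_cons, List.not_mem_nil, or_false] at hp
    rcases hp with rfl | rfl <;> simp only [List.mem_cons] at hF <;>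
      rcases hF with (rfl | hF) | hF
    · exact absurd hN hnp
    · exact keep (.inl hF)
    · exact keep (.inr hF)
    · exact absurd hN hnp
    · exact keep (.inl hF)
    · exact keep (.inr hF)
  | andR | andL1 | andL2 | orL | orR1 | orR2 | negR | negL | impR | impL | allR | allL | exR |
      exL =>
    simp only [List.mem_cons, List.not_mem_nil, or_false] at hp
    rcases hp with rfl | rfl <;>
      simp only [List.mem_cons, List.mem_append, Option.some.injEq, reduceCtorEq, or_false]
        at hF keep ⊢ <;>
      first
      | exact keep (by tauto)
      | grind [Subf]

/-- subformula property for predicate formulas: in any cut-free LJ+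
derivation, every non-propositional formula occurring in the derivation is a
subformula of some formula of the endsequent. -/
theorem ljplus_cutfree_predicate_subformula_property
    (t : DTree) (hc : t.Correct)
    (Γ' : List Formula) (Λ' : Option Formula) (hin : DTree.SeqIn (Γ', Λ') t)
    (F : Formula) (hF : F ∈ Γ' ∨ Λ' = some F) (hnp : ¬ F.Propositional) :
    ∃ G : Formula, (G ∈ t.root.1 ∨ t.root.2 = some G) ∧ Subf F G := by
  induction hin with
  | here ts => exact ⟨F, hF, .refl F⟩
  | there s ts t ht _ ih =>
    obtain ⟨_, _, hr, hts⟩ := hc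
    obtain ⟨G, hG, hFG⟩ := ih (hts t ht)
    obtain ⟨H, hH, hGH⟩ := hr.exists_subf_of_mem_premise (List.mem_map_of_mem ht) hG
      fun hp => hnp (hFG.propositional hp)
    exact ⟨H, hH, hFG.trans hGH⟩
end

section
/- Let K be a constrained Kripke structure. For any propositional formula A and any node k of K, either k forces A or k forces ¬A. Moreover, forcing of propositional formulas is downward persistent: for any nodes k and k' of K with k ≤ k', if k' forces A then k forces A. -/
/-- In a constrained Kripke structure, comparable nodes force the same propositional formulas. -/
theorem Kripke.Constrained.forces_iff {K : Kripke} (hK : K.Constrained) {A : Formula}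
    (hA : A.Propositional) {w w' : K.W} (h : K.le w w') (σ : ℕ → K.U) :
    K.forces w σ A ↔ K.forces w' σ A := by
  induction A generalizing w w' with
  | prop n => exact hK h n
  | pred | all | ex => exact hA.elim
  | top | bot => exact Iff.rfl
  | and A B ihA ihB => exact and_congr (ihA hA.1 h) (ihB hA.2 h)
  | or A B ihA ihB => exact or_congr (ihA hA.1 h) (ihB hA.2 h)
  | imp A B ihA ihB =>
    refine ⟨fun H v hv => H v (K.le_trans _ _ _ h hv), fun H v hv hvA => ?_⟩
    have hw'A := (ihA hA.1 h).1 ((ihA hA.1 hv).2 hvA)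
    exact (ihB hA.2 hv).1 ((ihB hA.2 h).2 (H w' (K.le_refl w') hw'A))
  | neg A ihA =>
    refine ⟨fun H v hv => H v (K.le_trans _ _ _ h hv), fun H v hv hvA => ?_⟩
    exact H w' (K.le_refl w') ((ihA hA h).1 ((ihA hA hv).2 hvA))

/-- in a constrained Kripke structure, every node forces A or
forces ¬A for any propositional formula A, and forcing of propositional
formulas is downward persistent. -/
theorem constrained_kripke_prop_classical_and_persistent
    (K : Kripke) (hK : K.Constrained) (A : Formula) (hA : A.Propositional) :
    (∀ (w : K.W) (σ : ℕ → K.U), K.forces w σ A ∨ K.forces w σ A.neg) ∧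
    (∀ (w w' : K.W) (σ : ℕ → K.U), K.le w w' → K.forces w' σ A → K.forces w σ A) := by
  refine ⟨fun w σ => ?_, fun w w' σ h => (hK.forces_iff hA h σ).2⟩
  by_cases hw : K.forces w σ A
  · exact Or.inl hw
  · exact Or.inr fun v hv hvA => hw ((hK.forces_iff hA hv σ).2 hvA)
end

section
/- In a constrained Kripke structure, forcing of propositional formulas is classical at every node: for any node k and propositional formulas A and B, k forces A ⊃ B if and only if (k forces A implies k forces B), and k forces ¬A if and only if k does not force A. -/
/-- In a constrained structure, comparable nodes force the same propositional formulas. -/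
theorem Kripke.Constrained.forces_iff_of_le {K : Kripke} (hK : K.Constrained) {A : Formula}
    (hA : A.Propositional) (σ : ℕ → K.U) {w w' : K.W} (h : K.le w w') :
    K.forces w σ A ↔ K.forces w' σ A := by
  induction A generalizing w w' with
  | prop n => exact hK h n
  | top => exact Iff.rfl
  | bot => exact Iff.rfl
  | and A B ihA ihB => exact and_congr (ihA hA.1 h) (ihB hA.2 h)
  | or A B ihA ihB => exact or_congr (ihA hA.1 h) (ihB hA.2 h)
  | imp A B ihA ihB =>
    refine ⟨fun f u hu => f u (K.le_trans _ _ _ h hu), fun f u hu a => ?_⟩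
    have b := f w' (K.le_refl w') ((ihA hA.1 h).1 ((ihA hA.1 hu).2 a))
    exact (ihB hA.2 hu).1 ((ihB hA.2 h).2 b)
  | neg A ihA =>
    refine ⟨fun f u hu => f u (K.le_trans _ _ _ h hu), fun f u hu a => ?_⟩
    exact f w' (K.le_refl w') ((ihA hA h).1 ((ihA hA hu).2 a))
  | pred | all | ex => exact hA.elim

/-- in a constrained Kripke structure, forcing of propositional
formulas is classical at every node: implication and negation are evaluated
locally. -/
theorem constrained_kripke_prop_forcing_classical
    (K : Kripke) (hK : K.Constrained) (A B : Formula)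
    (hA : A.Propositional) (hB : B.Propositional)
    (w : K.W) (σ : ℕ → K.U) :
    (K.forces w σ (A.imp B) ↔ (K.forces w σ A → K.forces w σ B)) ∧
    (K.forces w σ A.neg ↔ ¬ K.forces w σ A) := by
  exact ⟨⟨fun f => f w (K.le_refl w), fun f u hu a =>
      (hK.forces_iff_of_le hB σ hu).1 (f ((hK.forces_iff_of_le hA σ hu).2 a))⟩,
    ⟨fun f => f w (K.le_refl w), fun f u hu a => f ((hK.forces_iff_of_le hA σ hu).2 a)⟩⟩
end

section
/- Soundness of LJ+ with respect to constrained Kripke structures: every sequent Γ ⊢ Λ derivable in LJ+ is valid, i.e., for every node k of every constrained Kripke structure, either some formula of Γ is not forced at k, or Λ is nonempty and its formula is forced at k. In particular, every formula derivable in LJ+ is forced at all nodes of every constrained Kripke structure. -/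
namespace Formula

theorem rename_self (x : ℕ) (A : Formula) : A.rename x x = A := by
  induction A with
  | pred n y ys =>
    have h : (fun z : ℕ => if z = x then x else z) = id := by
      funext z; by_cases hz : z = x <;> simp [hz]
    have hy : (if y = x then x else y) = y := congrFun h y
    simp only [rename, h, hy, List.map_id]
  | _ => simp_all [rename]

theorem bv_subset_vars (A : Formula) : A.bv ⊆ A.vars := by
  induction A with
  | prop | pred | top | bot => simp [bv]
  | and A B ihA ihB | or A B ihA ihB | imp A B ihA ihB => exact Finset.union_subset_union ihA ihB
  | neg A ih => exact ih
  | all x A ih | ex x A ih => exact Finset.insert_subset_insert x ih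

end Formula

theorem fv_subset_fvList {A : Formula} {Γ : List Formula} (h : A ∈ Γ) : A.fv ⊆ fvList Γ := by
  induction Γ with
  | nil => simp at h
  | cons B Γ ih =>
    rcases List.mem_cons.1 h with rfl | h
    · exact Finset.subset_union_left
    · exact (ih h).trans Finset.subset_union_right

namespace Kripke

variable {K : Kripke}

theorem forces_mono {w w' : K.W} {σ : ℕ → K.U} {A : Formula} (hw : K.le w w')
    (h : K.forces w σ A) : K.forces w' σ A := by
  induction A generalizing w w' σ with
  | prop n => exact K.TP_mono hw n h
  | pred n x xs => exact K.TQ_mono hw n _ h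
  | top => exact h
  | bot => exact h
  | and A B ihA ihB => exact ⟨ihA hw h.1, ihB hw h.2⟩
  | or A B ihA ihB => exact h.imp (ihA hw) (ihB hw)
  | imp | neg | all => exact fun v hv => h v (K.le_trans _ _ _ hw hv)
  | ex x A ih =>
    obtain ⟨d, hd, h⟩ := h
    exact ⟨d, K.D_mono hw hd, ih hw h⟩

theorem forces_congr {w : K.W} {σ τ : ℕ → K.U} {A : Formula} (h : ∀ n ∈ A.fv, σ n = τ n) :
    K.forces w σ A ↔ K.forces w τ A := by
  induction A generalizing w σ τ with
  | prop | top | bot => exact Iff.rfl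
  | pred n x xs =>
    have : (x :: xs).map σ = (x :: xs).map τ :=
      List.map_congr_left fun y hy => h y (by simpa [Formula.fv] using hy)
    simp only [forces, this]
  | and A B ihA ihB =>
    exact and_congr (ihA fun n hn => h n (Finset.mem_union_left _ hn))
      (ihB fun n hn => h n (Finset.mem_union_right _ hn))
  | or A B ihA ihB =>
    exact or_congr (ihA fun n hn => h n (Finset.mem_union_left _ hn))
      (ihB fun n hn => h n (Finset.mem_union_right _ hn))
  | imp A B ihA ihB =>
    exact forall₂_congr fun _ _ => imp_congr (ihA fun n hn => h n (Finset.mem_union_left _ hn))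
      (ihB fun n hn => h n (Finset.mem_union_right _ hn))
  | neg A ih => exact forall₂_congr fun _ _ => not_congr (ih h)
  | all x A ih =>
    refine forall₂_congr fun _ _ => forall₂_congr fun d _ => ih fun n hn => ?_
    by_cases hx : n = x
    · simp [hx]
    · simpa [hx] using h n (Finset.mem_erase.2 ⟨hx, hn⟩)
  | ex x A ih =>
    refine exists_congr fun d => and_congr_right fun _ => ih fun n hn => ?_
    by_cases hx : n = x
    · simp [hx]
    · simpa [hx] using h n (Finset.mem_erase.2 ⟨hx, hn⟩)

theorem forces_rename_of_notMem_bv {x a : ℕ} {w : K.W} {σ : ℕ → K.U} {A : Formula}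
    (ha : a ∉ A.bv) :
    K.forces w σ (A.rename x a) ↔ K.forces w (Function.update σ x (σ a)) A := by
  induction A generalizing w σ with
  | prop | top | bot => exact Iff.rfl
  | pred n y ys =>
    have h : σ ∘ (fun z : ℕ => if z = x then a else z) = Function.update σ x (σ a) := by
      funext z; by_cases hz : z = x <;> simp [hz]
    simp only [Formula.rename, forces, ← h, List.map_cons, List.map_map, Function.comp_apply]
  | and A B ihA ihB =>
    simp only [Formula.bv, Finset.mem_union, not_or] at ha
    exact and_congr (ihA ha.1) (ihB ha.2)
  | or A B ihA ihB =>
    simp only [Formula.bv, Finset.mem_union, not_or] at ha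
    exact or_congr (ihA ha.1) (ihB ha.2)
  | imp A B ihA ihB =>
    simp only [Formula.bv, Finset.mem_union, not_or] at ha
    exact forall₂_congr fun _ _ => imp_congr (ihA ha.1) (ihB ha.2)
  | neg A ih => exact forall₂_congr fun _ _ => not_congr (ih ha)
  | all y A ih =>
    simp only [Formula.bv, Finset.mem_insert, not_or] at ha
    by_cases hy : y = x
    · simp [Formula.rename, forces, hy]
    · simp only [Formula.rename, hy, if_false, forces, ih ha.2, Function.update_of_ne ha.1,
        Function.update_comm hy]
  | ex y A ih =>
    simp only [Formula.bv, Finset.mem_insert, not_or] at ha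
    by_cases hy : y = x
    · simp [Formula.rename, forces, hy]
    · simp only [Formula.rename, hy, if_false, forces, ih ha.2, Function.update_of_ne ha.1,
        Function.update_comm hy]

theorem forces_rename {x a : ℕ} {w : K.W} {σ : ℕ → K.U} {A : Formula}
    (ha : a = x ∨ a ∉ A.bv) :
    K.forces w σ (A.rename x a) ↔ K.forces w (Function.update σ x (σ a)) A := by
  rcases ha with rfl | ha
  · rw [Formula.rename_self, Function.update_eq_self]
  · exact forces_rename_of_notMem_bv ha

/-- Interpreting an eigenvariable `a` by `d` amounts to interpreting the bound variable by `d`. -/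
theorem forces_update_rename {x a : ℕ} {w : K.W} {σ : ℕ → K.U} {d : K.U} {A : Formula}
    (ha : a ∉ A.fv.erase x) (hv : a ∉ A.vars) :
    K.forces w (Function.update σ a d) (A.rename x a) ↔
      K.forces w (Function.update σ x d) A := by
  rw [forces_rename (.inr fun h => hv (A.bv_subset_vars h)), Function.update_self]
  refine forces_congr fun n hn => ?_
  by_cases hx : n = x
  · simp [hx]
  · have hna : n ≠ a := fun h => ha (h ▸ Finset.mem_erase.2 ⟨hx, hn⟩)
    simp [hx, hna]

theorem forces_update_of_notMem_fv {a : ℕ} {w : K.W} {σ : ℕ → K.U} {d : K.U} {A : Formula}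
    (ha : a ∉ A.fv) : K.forces w (Function.update σ a d) A ↔ K.forces w σ A :=
  forces_congr fun _ hn => Function.update_of_ne (ne_of_mem_of_not_mem hn ha) _ _

theorem update_mem_D {w : K.W} {σ : ℕ → K.U} (hσ : ∀ n, σ n ∈ K.D w) {a : ℕ} {d : K.U}
    (hd : d ∈ K.D w) (n : ℕ) : Function.update σ a d n ∈ K.D w := by
  by_cases h : n = a
  · simpa [h] using hd
  · simpa [h] using hσ n

/-- In a constrained structure, forcing of a propositional formula is invariant along the order. -/
theorem Constrained.forces_iff_s12 (hK : K.Constrained) {w w' : K.W} {σ : ℕ → K.U} {N : Formula}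
    (hN : N.Propositional) (hw : K.le w w') : K.forces w σ N ↔ K.forces w' σ N := by
  refine ⟨forces_mono hw, fun h => ?_⟩
  induction N generalizing w w' with
  | prop n => exact (hK hw n).2 h
  | pred => exact hN.elim
  | top => exact h
  | bot => exact h
  | and A B ihA ihB => exact ⟨ihA hN.1 hw h.1, ihB hN.2 hw h.2⟩
  | or A B ihA ihB => exact h.imp (ihA hN.1 hw) (ihB hN.2 hw)
  | imp A B ihA ihB =>
    exact fun v hv hA => forces_mono hv <| ihB hN.2 hw <|
      h w' (K.le_refl w') <| forces_mono hw <| ihA hN.1 hv hA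
  | neg A ih =>
    exact fun v hv hA => h w' (K.le_refl w') <| forces_mono hw <| ih hN hv hA
  | all => exact hN.elim
  | ex => exact hN.elim

theorem Constrained.forces_or_forces_neg (hK : K.Constrained) (w : K.W) (σ : ℕ → K.U)
    {N : Formula} (hN : N.Propositional) : K.forces w σ N ∨ K.forces w σ N.neg :=
  or_iff_not_imp_left.2 fun h _ hw hN' => h ((hK.forces_iff_s12 hN hw).2 hN')

/-- A sequent holds in `K` if its succedent is forced wherever its whole antecedent is. -/
def Holds (K : Kripke) (s : Sequent) : Prop :=
  ∀ (w : K.W) (σ : ℕ → K.U), (∀ n, σ n ∈ K.D w) → (∀ A ∈ s.1, K.forces w σ A) →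
    ∃ A, s.2 = some A ∧ K.forces w σ A

theorem holds_some {Γ : List Formula} {A : Formula} :
    K.Holds (Γ, some A) ↔ ∀ (w : K.W) (σ : ℕ → K.U), (∀ n, σ n ∈ K.D w) →
      (∀ B ∈ Γ, K.forces w σ B) → K.forces w σ A := by
  simp [Holds]

theorem holds_none {Γ : List Formula} :
    K.Holds (Γ, none) ↔ ∀ (w : K.W) (σ : ℕ → K.U), (∀ n, σ n ∈ K.D w) →
      ¬ ∀ B ∈ Γ, K.forces w σ B := by
  simp [Holds]

theorem Constrained.holds_of_rule (hK : K.Constrained) {cut neut : Bool} {s : Sequent}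
    {ps : List Sequent} (hr : Rule cut neut NoLem s ps) (hp : ∀ p ∈ ps, K.Holds p) :
    K.Holds s := by
  induction hr with
  | ax A => exact holds_some.2 fun w σ _ h => h A (by simp)
  | topR => exact holds_some.2 fun w σ _ _ => trivial
  | botL => exact holds_none.2 fun w σ _ h => h .bot (by simp)
  | thinL A Γ Λ =>
    have h₁ := hp _ (.head _)
    exact fun w σ hσ h => h₁ w σ hσ (List.forall_mem_cons.1 h).2
  | thinR A Γ =>
    have h₁ := holds_none.1 (hp _ (.head _))
    exact fun w σ hσ h => (h₁ w σ hσ h).elim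
  | contr A Γ Λ =>
    have h₁ := hp _ (.head _)
    exact fun w σ hσ h => h₁ w σ hσ (List.forall_mem_cons.2 ⟨h A (.head _), h⟩)
  | exch Δ Γ A B Λ =>
    have h₁ := hp _ (.head _)
    refine fun w σ hσ h => h₁ w σ hσ fun C hC => h C ?_
    simp only [List.mem_append, List.mem_cons] at hC ⊢
    tauto
  | cut' Γ Δ C Λ =>
    have h₁ := holds_some.1 (hp _ (.head _))
    have h₂ := hp _ (.tail _ (.head _))
    intro w σ hσ h
    obtain ⟨hΓ, hΔ⟩ := List.forall_mem_append.1 h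
    exact h₂ w σ hσ (List.forall_mem_cons.2 ⟨h₁ w σ hσ hΓ, hΔ⟩)
  | andR Γ A B =>
    have h₁ := holds_some.1 (hp _ (.head _))
    have h₂ := holds_some.1 (hp _ (.tail _ (.head _)))
    exact holds_some.2 fun w σ hσ h => ⟨h₁ w σ hσ h, h₂ w σ hσ h⟩
  | andL1 A B Γ Λ =>
    have h₁ := hp _ (.head _)
    intro w σ hσ h
    obtain ⟨hAB, hΓ⟩ := List.forall_mem_cons.1 h
    exact h₁ w σ hσ (List.forall_mem_cons.2 ⟨hAB.1, hΓ⟩)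
  | andL2 A B Γ Λ =>
    have h₁ := hp _ (.head _)
    intro w σ hσ h
    obtain ⟨hAB, hΓ⟩ := List.forall_mem_cons.1 h
    exact h₁ w σ hσ (List.forall_mem_cons.2 ⟨hAB.2, hΓ⟩)
  | orL A B Γ Λ =>
    have h₁ := hp _ (.head _)
    have h₂ := hp _ (.tail _ (.head _))
    intro w σ hσ h
    obtain ⟨hA | hB, hΓ⟩ := List.forall_mem_cons.1 h
    · exact h₁ w σ hσ (List.forall_mem_cons.2 ⟨hA, hΓ⟩)
    · exact h₂ w σ hσ (List.forall_mem_cons.2 ⟨hB, hΓ⟩)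
  | orR1 Γ A B =>
    have h₁ := holds_some.1 (hp _ (.head _))
    exact holds_some.2 fun w σ hσ h => .inl (h₁ w σ hσ h)
  | orR2 Γ A B =>
    have h₁ := holds_some.1 (hp _ (.head _))
    exact holds_some.2 fun w σ hσ h => .inr (h₁ w σ hσ h)
  | negR A Γ =>
    have h₁ := holds_none.1 (hp _ (.head _))
    exact holds_some.2 fun w σ hσ h v hv hA => h₁ v σ (fun n => K.D_mono hv (hσ n))
      (List.forall_mem_cons.2 ⟨hA, fun B hB => forces_mono hv (h B hB)⟩)
  | negL A Γ =>
    have h₁ := holds_some.1 (hp _ (.head _))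
    refine holds_none.2 fun w σ hσ h => ?_
    obtain ⟨hA, hΓ⟩ := List.forall_mem_cons.1 h
    exact hA w (K.le_refl w) (h₁ w σ hσ hΓ)
  | impR A B Γ =>
    have h₁ := holds_some.1 (hp _ (.head _))
    exact holds_some.2 fun w σ hσ h v hv hA => h₁ v σ (fun n => K.D_mono hv (hσ n))
      (List.forall_mem_cons.2 ⟨hA, fun B hB => forces_mono hv (h B hB)⟩)
  | impL A B Γ Δ Λ =>
    have h₁ := holds_some.1 (hp _ (.head _))
    have h₂ := hp _ (.tail _ (.head _))
    intro w σ hσ h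
    obtain ⟨hAB, hΓΔ⟩ := List.forall_mem_cons.1 h
    obtain ⟨hΓ, hΔ⟩ := List.forall_mem_append.1 hΓΔ
    exact h₂ w σ hσ
      (List.forall_mem_cons.2 ⟨hAB w (K.le_refl w) (h₁ w σ hσ hΓ), hΔ⟩)
  | allR Γ x a G ha hv =>
    have h₁ := holds_some.1 (hp _ (.head _))
    obtain ⟨haΓ, haG⟩ := not_or.1 (mt Finset.mem_union.2 ha)
    refine holds_some.2 fun w σ hσ h v hwv d hd => (forces_update_rename haG hv).1 ?_
    refine h₁ v _ (update_mem_D (fun n => K.D_mono hwv (hσ n)) hd) fun B hB => ?_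
    exact (forces_update_of_notMem_fv fun hn => haΓ (fv_subset_fvList hB hn)).2
      (forces_mono hwv (h B hB))
  | allL x G a Γ Λ hc =>
    have h₁ := hp _ (.head _)
    intro w σ hσ h
    obtain ⟨hG, hΓ⟩ := List.forall_mem_cons.1 h
    exact h₁ w σ hσ
      (List.forall_mem_cons.2 ⟨(forces_rename hc).2 (hG w (K.le_refl w) _ (hσ a)), hΓ⟩)
  | exR Γ x G a hc =>
    have h₁ := holds_some.1 (hp _ (.head _))
    exact holds_some.2 fun w σ hσ h => ⟨σ a, hσ a, (forces_rename hc).1 (h₁ w σ hσ h)⟩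
  | exL x G a Γ Λ ha hv =>
    have h₁ := hp _ (.head _)
    obtain ⟨haΓG, haΛ⟩ := not_or.1 (mt Finset.mem_union.2 ha)
    obtain ⟨haΓ, haG⟩ := not_or.1 (mt Finset.mem_union.2 haΓG)
    intro w σ hσ h
    obtain ⟨⟨d, hd, hG⟩, hΓ⟩ := List.forall_mem_cons.1 h
    obtain ⟨C, rfl, hC⟩ := h₁ w _ (update_mem_D hσ hd) (List.forall_mem_cons.2
      ⟨(forces_update_rename haG hv).2 hG, fun B hB =>
        (forces_update_of_notMem_fv fun hn => haΓ (fv_subset_fvList hB hn)).2 (hΓ B hB)⟩)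
    exact ⟨C, rfl, (forces_update_of_notMem_fv haΛ).1 hC⟩
  | neut' N Γ Λ _ hN =>
    have h₁ := hp _ (.head _)
    have h₂ := hp _ (.tail _ (.head _))
    intro w σ hσ h
    rcases hK.forces_or_forces_neg w σ hN with hN | hN
    · exact h₁ w σ hσ (List.forall_mem_cons.2 ⟨hN, h⟩)
    · exact h₂ w σ hσ (List.forall_mem_cons.2 ⟨hN, h⟩)
  | lemAx A h => exact h.elim

theorem Constrained.holds_of_ljPlus (hK : K.Constrained) {s : Sequent} (hs : LJPlus s) :
    K.Holds s := by
  induction hs with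
  | step hr _ ih => exact hK.holds_of_rule hr ih

end Kripke

/-- soundness of LJ+ with respect to constrained Kripke
structures: every derivable sequent is valid; in particular every formula
derivable in LJ+ is forced at all nodes of every constrained Kripke structure. -/
theorem ljplus_sound_constrained_kripke :
    (∀ s : Sequent, LJPlus s → SeqValid s) ∧
    (∀ F : Formula, LJPlusThm F → ∀ K : Kripke, K.Constrained →
      ∀ (w : K.W) (σ : ℕ → K.U), (∀ n, σ n ∈ K.D w) → K.forces w σ F) := by
  refine ⟨fun s hs K hK w σ hσ => ?_, fun F hF K hK w σ hσ =>
    Kripke.holds_some.1 (hK.holds_of_ljPlus hF) w σ hσ (by simp)⟩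
  by_cases h : ∀ A ∈ s.1, K.forces w σ A
  · exact .inr (hK.holds_of_ljPlus hs w σ hσ h)
  · push Not at h
    exact .inl h
end
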